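/- arXiv:1803.04443 — 6 statements merged into one kernel-verified Lean document; each statement's English description precedes it below -/
import Mathlib

section
/- Let A be an associative unital ring and D, Q ∈ A. Set S₀ = 1 − Q*D and S₁ = 1 − D*Q, let V = !![S₀, −(1 + S₀)*Q; D, S₁] and W = !![S₀, (1 + S₀)*Q; −D, S₁] (so that V*W = W*V = 1), and let e = !![1, 0; 0, 0]. Then V*e*W = !![S₀*S₀, S₀*(1 + S₀)*Q; S₁*D, 1 − S₁*S₁], and this matrix is an idempotent of M₂(A). -/
/-- With `S₀ = 1 - Q*D`, `S₁ = 1 - D*Q`,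
`V = !![S₀, -(1+S₀)*Q; D, S₁]`, `W = !![S₀, (1+S₀)*Q; -D, S₁]` (the inverse of `V`)
and `e = !![1, 0; 0, 0]`, one has
`V*e*W = !![S₀*S₀, S₀*(1+S₀)*Q; S₁*D, 1 - S₁*S₁]`, and this matrix is idempotent. -/
theorem stmt1 {A : Type*} [Ring A] (D Q S₀ S₁ : A)
    (hS₀ : S₀ = 1 - Q * D) (hS₁ : S₁ = 1 - D * Q)
    (V W e : Matrix (Fin 2) (Fin 2) A)
    (hV : V = !![S₀, -((1 + S₀) * Q); D, S₁])
    (hW : W = !![S₀, (1 + S₀) * Q; -D, S₁])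
    (he : e = !![1, 0; 0, 0]) :
    V * e * W = !![S₀ * S₀, S₀ * ((1 + S₀) * Q); S₁ * D, 1 - S₁ * S₁] ∧
      IsIdempotentElem (V * e * W) := by
  have hWV : W * V = 1 := by
    subst hV hW hS₀ hS₁
    rw [Matrix.mul_fin_two, Matrix.one_fin_two]
    congr! <;> noncomm_ring
  have hee : e * e = e := by
    subst he
    rw [Matrix.mul_fin_two]
    simp only [mul_zero, mul_one, add_zero]
  constructor
  · subst hV hW he hS₀ hS₁
    rw [Matrix.mul_fin_two, Matrix.mul_fin_two]
    congr! 1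
    ext i j
    fin_cases i <;> fin_cases j <;> simp <;> noncomm_ring
  · unfold IsIdempotentElem
    calc V * e * W * (V * e * W) = V * e * (W * V) * e * W := by simp only [mul_assoc]
      _ = V * (e * e) * W := by rw [hWV]; simp only [mul_assoc, one_mul]
      _ = V * e * W := by rw [hee]
end

section
/- Let A be an associative unital ring, J ⊆ A a two-sided ideal, and D, Q ∈ A such that S₀ = 1 − Q*D and S₁ = 1 − D*Q both lie in J. With V = !![S₀, −(1 + S₀)*Q; D, S₁], W = !![S₀, (1 + S₀)*Q; −D, S₁] and e = !![1, 0; 0, 0], every entry of the matrix V*e*W − !![0, 0; 0, 1] lies in J; in particular the difference of matrix traces tr(V*e*W) − tr(e) = S₀*S₀ − S₁*S₁ lies in J. -/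
/-- If `J` is a two-sided ideal of `A` and `S₀ = 1 - Q*D`,
`S₁ = 1 - D*Q` both lie in `J`, then with `V`, `W`, `e` as before, every entry of
`V*e*W - !![0, 0; 0, 1]` lies in `J`; in particular the difference of traces
`tr(V*e*W) - tr(e)` equals `S₀*S₀ - S₁*S₁` and lies in `J`. -/
theorem stmt2 {A : Type*} [Ring A] (J : TwoSidedIdeal A) (D Q S₀ S₁ : A)
    (hS₀ : S₀ = 1 - Q * D) (hS₁ : S₁ = 1 - D * Q)
    (hS₀J : S₀ ∈ J) (hS₁J : S₁ ∈ J)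
    (V W e : Matrix (Fin 2) (Fin 2) A)
    (hV : V = !![S₀, -((1 + S₀) * Q); D, S₁])
    (hW : W = !![S₀, (1 + S₀) * Q; -D, S₁])
    (he : e = !![1, 0; 0, 0]) :
    (∀ i j : Fin 2, ((V * e * W - !![0, 0; 0, 1] : Matrix (Fin 2) (Fin 2) A) i j) ∈ J) ∧
      Matrix.trace (V * e * W) - Matrix.trace e = S₀ * S₀ - S₁ * S₁ ∧
      Matrix.trace (V * e * W) - Matrix.trace e ∈ J := by
  have h11 : D * ((1 + S₀) * Q) = 1 - S₁ * S₁ := by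
    rw [hS₀, hS₁]; noncomm_ring
  have hM : V * e * W = !![S₀ * S₀, S₀ * ((1 + S₀) * Q); D * S₀, 1 - S₁ * S₁] := by
    rw [← h11, hV, hW, he]
    ext i j
    fin_cases i <;> fin_cases j <;> simp [Matrix.mul_apply, Fin.sum_univ_two]
  have ht : Matrix.trace (V * e * W) - Matrix.trace e = S₀ * S₀ - S₁ * S₁ := by
    rw [hM, he]
    simp only [Matrix.trace_fin_two_of]
    abel
  refine ⟨?_, ht, ?_⟩
  · rw [hM]
    intro i j
    fin_cases i <;> fin_cases j
    · simpa using J.mul_mem_left S₀ S₀ hS₀J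
    · simpa using J.mul_mem_right S₀ ((1 + S₀) * Q) hS₀J
    · simpa using J.mul_mem_left D S₀ hS₀J
    · simpa using J.neg_mem (J.mul_mem_left S₁ S₁ hS₁J)
  · rw [ht]
    exact J.sub_mem (J.mul_mem_left S₀ S₀ hS₀J) (J.mul_mem_left S₁ S₁ hS₁J)
end

section
/- Let A be a unital real Banach algebra, e ∈ A an idempotent (e*e = e), v ∈ A invertible, and for t ∈ ℝ let e(t) = !![(cos t)²•(v*e*v⁻¹), (sin t * cos t)•(v*e); (sin t * cos t)•(e*v⁻¹), (sin t)²•e] ∈ M₂(A). Then for every t ∈ ℝ the map s ↦ e(s) is differentiable at t with derivative ė(t) = !![(−sin(2t))•(v*e*v⁻¹), (cos(2t))•(v*e); (cos(2t))•(e*v⁻¹), (sin(2t))•e], and moreover (2•e(t) − 1)*ė(t) = !![0, v*e; −(e*v⁻¹), 0] for every t ∈ ℝ. -/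
open Real

attribute [local instance] Matrix.normedAddCommGroup Matrix.normedSpace

/-- In a unital real Banach algebra `A`, for an idempotent `e` and an
invertible `v`, the path of idempotents
`e(t) = !![cos²t • (v e v⁻¹), (sin t cos t) • (v e); (sin t cos t) • (e v⁻¹), sin²t • e]`
is differentiable at every `t` with derivative
`ė(t) = !![(-sin 2t) • (v e v⁻¹), (cos 2t) • (v e); (cos 2t) • (e v⁻¹), (sin 2t) • e]`,
and `(2 • e(t) - 1) * ė(t) = !![0, v e; -(e v⁻¹), 0]` for every `t`. -/
theorem stmt5 {A : Type*} [NormedRing A] [NormedAlgebra ℝ A] [CompleteSpace A]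
    (e : A) (he : e * e = e) (v : Aˣ)
    (E E' : ℝ → Matrix (Fin 2) (Fin 2) A)
    (hE : ∀ t : ℝ, E t =
      !![(cos t) ^ 2 • ((v : A) * e * (↑v⁻¹ : A)), (sin t * cos t) • ((v : A) * e);
         (sin t * cos t) • (e * (↑v⁻¹ : A)), (sin t) ^ 2 • e])
    (hE' : ∀ t : ℝ, E' t =
      !![(-sin (2 * t)) • ((v : A) * e * (↑v⁻¹ : A)), (cos (2 * t)) • ((v : A) * e);
         (cos (2 * t)) • (e * (↑v⁻¹ : A)), (sin (2 * t)) • e]) :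
    (∀ t : ℝ, HasDerivAt E (E' t) t) ∧
      (∀ t : ℝ, ((2 : ℝ) • E t - 1) * E' t = !![0, (v : A) * e; -(e * (↑v⁻¹ : A)), 0]) := by
  have c2 : ∀ t : ℝ, cos (2 * t) = cos t ^ 2 - sin t ^ 2 := fun t => cos_two_mul' t
  have s2 : ∀ t : ℝ, sin (2 * t) = 2 * sin t * cos t := fun t => sin_two_mul t
  constructor
  · intro t
    have hs := hasDerivAt_sin t
    have hc := hasDerivAt_cos t
    have h1 : HasDerivAt (fun t : ℝ => cos t ^ 2) (-sin (2 * t)) t := by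
      refine (hc.pow 2).congr_deriv ?_
      rw [s2]; push_cast; ring
    have h2 : HasDerivAt (fun t : ℝ => sin t * cos t) (cos (2 * t)) t := by
      refine (hs.mul hc).congr_deriv ?_
      rw [c2]; ring
    have h3 : HasDerivAt (fun t : ℝ => sin t ^ 2) (sin (2 * t)) t := by
      refine (hs.pow 2).congr_deriv ?_
      rw [s2]; push_cast; ring
    have hEf := funext hE
    rw [hEf, hE']
    refine hasDerivAt_pi.2 fun i => hasDerivAt_pi.2 fun j => ?_
    fin_cases i <;> fin_cases j
    · exact h1.smul_const _
    · exact h2.smul_const _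
    · exact h2.smul_const _
    · exact h3.smul_const _
  · intro t
    have hsc := sin_sq_add_cos_sq t
    have e1 : ∀ x : A, e * (e * x) = e * x := fun x => by rw [← mul_assoc, he]
    rw [hE, hE', c2, s2, Matrix.one_fin_two]
    have hs : sin t ^ 2 = 1 - cos t ^ 2 := by linarith
    ext i j
    fin_cases i <;> fin_cases j <;>
      simp [Matrix.mul_apply, Fin.sum_univ_two, sub_mul, mul_assoc, he, e1, smul_smul] <;>
      match_scalars <;> grind
end

section
/- Let m ≥ 1 and let φ : (ℝ^m)^{m+1} → ℝ be a C^∞ function that is totally antisymmetric: for every permutation ν of {0, …, m} and all x₀, …, x_m ∈ ℝ^m, φ(x_{ν(0)}, …, x_{ν(m)}) = sgn(ν)·φ(x₀, …, x_m). Then for every x ∈ ℝ^m and every natural number j ≤ m − 1, the j-th iterated Fréchet derivative of φ vanishes at the diagonal point (x, x, …, x). -/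
/-- Let `m ≥ 1` and let `φ : (ℝ^m)^{m+1} → ℝ` be a totally antisymmetric
`C^∞` function. Then for every `x ∈ ℝ^m` and every `j ≤ m - 1`, the `j`-th iterated
Fréchet derivative of `φ` vanishes at the diagonal point `(x, …, x)`. -/
theorem stmt16 (m : ℕ) (hm : 1 ≤ m)
    (φ : (Fin (m + 1) → (Fin m → ℝ)) → ℝ)
    (hsmooth : ContDiff ℝ (⊤ : ℕ∞) φ)
    (hanti : ∀ (ν : Equiv.Perm (Fin (m + 1))) (x : Fin (m + 1) → (Fin m → ℝ)),
      φ (x ∘ ν) = ((Equiv.Perm.sign ν : ℤ) : ℝ) * φ x)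
    (x : Fin m → ℝ) (j : ℕ) (hj : j ≤ m - 1) :
    iteratedFDeriv ℝ j φ (fun _ => x) = 0 := by
  have hsm : ContDiff ℝ (j : WithTop ℕ∞) φ := hsmooth.of_le (by exact_mod_cast le_top)
  ext v
  have hv : v = fun i => ∑ a : Fin (m + 1), Pi.single a (v i a) := by
    funext i
    exact (Finset.univ_sum_single (v i)).symm
  rw [hv, ContinuousMultilinearMap.map_sum]
  refine Finset.sum_eq_zero fun r _ => ?_
  -- two slots not used by `r`
  have hcard : 1 < (Finset.univ.image r)ᶜ.card := by
    rw [Finset.card_compl, Fintype.card_fin]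
    have : (Finset.univ.image r).card ≤ j := by
      simpa using (Finset.card_image_le (s := Finset.univ) (f := r))
    omega
  obtain ⟨a, ha, b, hb, hab⟩ := Finset.one_lt_card.1 hcard
  have ha' : ∀ i, r i ≠ a := by simpa using ha
  have hb' : ∀ i, r i ≠ b := by simpa using hb
  let L : (Fin (m + 1) → (Fin m → ℝ)) →L[ℝ] (Fin (m + 1) → (Fin m → ℝ)) :=
    ContinuousLinearMap.pi fun i => ContinuousLinearMap.proj (Equiv.swap a b i)
  have hL : ∀ y, L y = y ∘ Equiv.swap a b := fun y => rfl
  have hcomp : φ ∘ L = -φ := by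
    funext y
    have h := hanti (Equiv.swap a b) y
    rw [Equiv.Perm.sign_swap hab] at h
    simpa [hL] using h
  have key := L.iteratedFDeriv_comp_right hsm (fun _ => x) (i := j) le_rfl
  rw [hcomp, iteratedFDeriv_neg] at key
  have hx : L (fun _ => x) = fun _ => x := rfl
  rw [hx] at key
  have key2 := congrArg (fun T => T (fun i => Pi.single (r i) (v i (r i)))) key
  have hfix : ∀ i, L (Pi.single (r i) (v i (r i))) = Pi.single (r i) (v i (r i)) := by
    intro i
    rw [hL]
    funext k
    simp only [Function.comp_apply]
    by_cases hka : k = a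
    · subst hka
      rw [Equiv.swap_apply_left, Pi.single_eq_of_ne (hb' i).symm,
        Pi.single_eq_of_ne (ha' i).symm]
    · by_cases hkb : k = b
      · subst hkb
        rw [Equiv.swap_apply_right, Pi.single_eq_of_ne (hb' i).symm,
          Pi.single_eq_of_ne (ha' i).symm]
      · rw [Equiv.swap_apply_of_ne_of_ne hka hkb]
  simp only [ContinuousMultilinearMap.compContinuousLinearMap_apply, hfix, Pi.neg_apply,
    ContinuousMultilinearMap.neg_apply] at key2
  linarith
end

section
/- Let m ≥ 1 and let q > m be natural numbers, and let φ : (ℝ^m)^{q+1} → ℝ be a C^∞ function that is totally antisymmetric: for every permutation ν of {0, …, q} and all x₀, …, x_q ∈ ℝ^m, φ(x_{ν(0)}, …, x_{ν(q)}) = sgn(ν)·φ(x₀, …, x_q). Then for every x ∈ ℝ^m and every natural number j ≤ m, the j-th iterated Fréchet derivative of φ vanishes at the diagonal point (x, …, x). -/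
/-- Let `m ≥ 1`, `q > m`, and let `φ : (ℝ^m)^{q+1} → ℝ` be a totally
antisymmetric `C^∞` function. Then for every `x ∈ ℝ^m` and every `j ≤ m`, the `j`-th
iterated Fréchet derivative of `φ` vanishes at the diagonal point `(x, …, x)`. -/
theorem stmt17 (m q : ℕ) (hm : 1 ≤ m) (hq : m < q)
    (φ : (Fin (q + 1) → (Fin m → ℝ)) → ℝ)
    (hsmooth : ContDiff ℝ (⊤ : ℕ∞) φ)
    (hanti : ∀ (ν : Equiv.Perm (Fin (q + 1))) (x : Fin (q + 1) → (Fin m → ℝ)),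
      φ (x ∘ ν) = ((Equiv.Perm.sign ν : ℤ) : ℝ) * φ x)
    (x : Fin m → ℝ) (j : ℕ) (hj : j ≤ m) :
    iteratedFDeriv ℝ j φ (fun _ => x) = 0 := by
  classical
  ext v
  have hv : v = fun i => ∑ k, (Pi.single k (v i k) : Fin (q + 1) → (Fin m → ℝ)) := by
    funext i
    exact (Finset.univ_sum_single (v i)).symm
  rw [hv, ContinuousMultilinearMap.map_sum]
  refine Finset.sum_eq_zero fun s _ => ?_
  -- two slots not hit by `s`
  have hcard : 1 < ((Finset.univ.image s)ᶜ).card := by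
    rw [Finset.card_compl, Fintype.card_fin]
    have h1 : (Finset.univ.image s).card ≤ j := by
      simpa using (Finset.card_image_le (s := Finset.univ) (f := s))
    omega
  obtain ⟨a, ha, b, hb, hab⟩ := Finset.one_lt_card.mp hcard
  have ha' : ∀ i, s i ≠ a := by simpa using ha
  have hb' : ∀ i, s i ≠ b := by simpa using hb
  let g : (Fin (q + 1) → (Fin m → ℝ)) →L[ℝ] (Fin (q + 1) → (Fin m → ℝ)) :=
    ContinuousLinearMap.pi fun k => ContinuousLinearMap.proj (Equiv.swap a b k)
  have hg : ∀ y, g y = y ∘ Equiv.swap a b := fun y => rfl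
  have hcomp : φ ∘ g = -φ := by
    funext y
    simp [hg, hanti, Equiv.Perm.sign_swap hab]
  have key := g.iteratedFDeriv_comp_right hsmooth (fun _ => x) (i := j)
    (by exact_mod_cast le_top)
  rw [hcomp, iteratedFDeriv_neg_apply] at key
  have hgx : g (fun _ => x) = fun _ => x := rfl
  rw [hgx] at key
  have key2 := congrArg (fun T => T fun i =>
    (Pi.single (s i) (v i (s i)) : Fin (q + 1) → (Fin m → ℝ))) key
  have hfix : ∀ i, g (Pi.single (s i) (v i (s i))) = Pi.single (s i) (v i (s i)) := by
    intro i
    rw [hg]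
    funext k
    by_cases hka : k = a
    · subst hka
      simp [Pi.single_apply, (ha' i).symm, (hb' i).symm]
    · by_cases hkb : k = b
      · subst hkb
        simp [Pi.single_apply, (ha' i).symm, (hb' i).symm]
      · simp [Equiv.swap_apply_of_ne_of_ne hka hkb]
  simp only [ContinuousMultilinearMap.neg_apply,
    ContinuousMultilinearMap.compContinuousLinearMap_apply, hfix] at key2
  linarith
end

section
/- Let n ≥ 1 and let P be a multivariate polynomial with real coefficients in the variables {X_{i,a} : i ∈ {0, …, n}, a ∈ {1, …, n}}, regarded as a polynomial function of n+1 vector variables x₀, …, x_n ∈ ℝⁿ (with X_{i,a} the a-th coordinate of x_i). Suppose P is alternating: for every permutation ν of {0, …, n}, the relabelling of variables X_{i,a} ↦ X_{ν(i),a} sends P to sgn(ν)·P. If the total degree of P is at most n − 1, then P = 0. -/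
/-- Let `n ≥ 1` and let `P` be a real multivariate polynomial in the
variables `X_{i,a}` (`i ∈ {0, …, n}`, `a ∈ {1, …, n}`), alternating under the relabelling
`X_{i,a} ↦ X_{ν(i),a}` for every permutation `ν` of `{0, …, n}` (which sends `P` to
`sgn(ν)·P`). If the total degree of `P` is at most `n - 1`, then `P = 0`. -/
theorem stmt18 (n : ℕ) (hn : 1 ≤ n)
    (P : MvPolynomial (Fin (n + 1) × Fin n) ℝ)
    (halt : ∀ ν : Equiv.Perm (Fin (n + 1)),
      MvPolynomial.rename (fun p : Fin (n + 1) × Fin n => (ν p.1, p.2)) P =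
        ((Equiv.Perm.sign ν : ℤ) : ℝ) • P)
    (hdeg : P.totalDegree ≤ n - 1) :
    P = 0 := by
  classical
  ext d
  rw [MvPolynomial.coeff_zero]
  by_contra hd
  have h1 := MvPolynomial.le_totalDegree (MvPolynomial.mem_support_iff.mpr hd)
  have h2 : d.support.card ≤ d.sum fun _ e => e := by
    rw [Finsupp.sum, Finset.card_eq_sum_ones]
    refine Finset.sum_le_sum fun i hi => ?_
    exact Nat.one_le_iff_ne_zero.mpr (Finsupp.mem_support_iff.mp hi)
  have h3 : (d.support.image Prod.fst).card ≤ d.support.card := Finset.card_image_le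
  have h4 : 1 < ((d.support.image Prod.fst)ᶜ).card := by
    rw [Finset.card_compl, Fintype.card_fin]
    omega
  obtain ⟨i, hi, j, hj, hij⟩ := Finset.one_lt_card.mp h4
  have key : ∀ k, k ∈ (d.support.image Prod.fst)ᶜ → ∀ a, d (k, a) = 0 := by
    intro k hk a
    by_contra h
    exact (Finset.mem_compl.mp hk)
      (Finset.mem_image.mpr ⟨(k, a), Finsupp.mem_support_iff.mpr h, rfl⟩)
  have hinj : Function.Injective
      (fun p : Fin (n + 1) × Fin n => (Equiv.swap i j p.1, p.2)) := by
    rintro ⟨a, b⟩ ⟨c, e⟩ h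
    simpa using h
  have hmap : d.mapDomain (fun p : Fin (n + 1) × Fin n => (Equiv.swap i j p.1, p.2)) = d := by
    ext ⟨k, a⟩
    have h5 := Finsupp.mapDomain_apply hinj d (Equiv.swap i j k, a)
    simp only [Equiv.swap_apply_self] at h5
    rw [h5]
    by_cases hki : k = i
    · subst hki
      rw [Equiv.swap_apply_left, key _ hi, key _ hj]
    by_cases hkj : k = j
    · subst hkj
      rw [Equiv.swap_apply_right, key _ hi, key _ hj]
    rw [Equiv.swap_apply_of_ne_of_ne hki hkj]
  have h6 := MvPolynomial.coeff_rename_mapDomain _ hinj P d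
  rw [hmap, halt (Equiv.swap i j), Equiv.Perm.sign_swap hij, MvPolynomial.coeff_smul] at h6
  apply hd
  simp at h6
  linarith
end
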